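/- arXiv:1310.6271 — 2 statements merged into one kernel-verified Lean document; each statement's English description precedes it below -/
import Mathlib

section
/- Let C = P ⨟ S be a sorting network of depth d on n channels, where ⨟ denotes composition of comparator networks (concatenation of their layer sequences), and let Q be a comparator network on n channels with depth(P) = depth(Q) and outputs(Q) ⊆ outputs(P). Then Q ⨟ S is a sorting network of depth d. -/
/-- A comparator on `n` channels: an ordered pair of channel indices
(the first component receives the minimum, the second the maximum). -/
abbrev Comparator (n : ℕ) : Type := Fin n × Fin n

/-- A layer of a comparator network: a list of comparators. -/
abbrev Layer (n : ℕ) : Type := List (Comparator n)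

/-- A comparator network: a list of layers; its depth is the length of this list. -/
abbrev Network (n : ℕ) : Type := List (Layer n)

/-- Two comparators are channel-disjoint if they share no channel. -/
def ChDisjoint {n : ℕ} (c d : Comparator n) : Prop :=
  c.1 ≠ d.1 ∧ c.1 ≠ d.2 ∧ c.2 ≠ d.1 ∧ c.2 ≠ d.2

/-- A valid (ordinary) layer: every comparator `⟨i,j⟩` satisfies `i < j`
and every channel occurs at most once in the layer. -/
def IsLayer {n : ℕ} (L : Layer n) : Prop :=
  (∀ c ∈ L, c.1 < c.2) ∧ L.Pairwise ChDisjoint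

/-- A valid (ordinary) comparator network: all its layers are valid layers. -/
def IsNetwork {n : ℕ} (C : Network n) : Prop := ∀ L ∈ C, IsLayer L

/-- Applying the comparator `c = ⟨i,j⟩` to a vector of values:
channel `i` receives the minimum and channel `j` the maximum of the
values on channels `i` and `j`; all other channels are unchanged. -/
def applyComparator {n : ℕ} {α : Type*} [LinearOrder α] (c : Comparator n)
    (v : Fin n → α) : Fin n → α := fun k =>
  if k = c.1 then min (v c.1) (v c.2)
  else if k = c.2 then max (v c.1) (v c.2)
  else v k

/-- Applying a layer: apply all its comparators (they act on disjoint channels). -/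
def applyLayer {n : ℕ} {α : Type*} [LinearOrder α] (L : Layer n)
    (v : Fin n → α) : Fin n → α :=
  L.foldl (fun w c => applyComparator c w) v

/-- Applying a network: apply its layers in sequence; `applyNetwork C x` is `C(x)`. -/
def applyNetwork {n : ℕ} {α : Type*} [LinearOrder α] (C : Network n)
    (v : Fin n → α) : Fin n → α :=
  C.foldl (fun w L => applyLayer L w) v

/-- `C` sorts every Boolean input: `C(x)` is sorted ascendingly for all `x ∈ {0,1}ⁿ`. -/
def Sorts {n : ℕ} (C : Network n) : Prop :=
  ∀ x : Fin n → Bool, Monotone (applyNetwork C x)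

/-- A sorting network: a valid comparator network sorting every Boolean input. -/
def IsSortingNetwork {n : ℕ} (C : Network n) : Prop := IsNetwork C ∧ Sorts C

/-- The set of all possible outputs of `C` on Boolean inputs. -/
def outputs {n : ℕ} (C : Network n) : Set (Fin n → Bool) :=
  Set.range (fun x : Fin n → Bool => applyNetwork C x)

theorem applyNetwork_append {n : ℕ} {α : Type*} [LinearOrder α] (C D : Network n)
    (v : Fin n → α) : applyNetwork (C ++ D) v = applyNetwork D (applyNetwork C v) :=
  List.foldl_append

/-- if `C = P ⨟ S` is a sorting network of depth `d` and `Q` is a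
comparator network with `depth(Q) = depth(P)` and `outputs(Q) ⊆ outputs(P)`, then
`Q ⨟ S` is a sorting network of depth `d`. -/
theorem statement_3 {n d : ℕ} (P S Q : Network n) (hQ : IsNetwork Q)
    (hC : IsSortingNetwork (P ++ S)) (hd : (P ++ S).length = d)
    (hdepth : Q.length = P.length) (hout : outputs Q ⊆ outputs P) :
    IsSortingNetwork (Q ++ S) ∧ (Q ++ S).length = d := by
  obtain ⟨hN, hS⟩ := hC
  refine ⟨⟨fun L hL => ?_, fun x => ?_⟩, by simp_all⟩
  · rcases List.mem_append.mp hL with h | h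
    · exact hQ L h
    · exact hN L (List.mem_append_right P h)
  · obtain ⟨y, hy⟩ := hout ⟨x, rfl⟩
    have key := hS y
    rw [applyNetwork_append] at key ⊢
    rwa [← show applyNetwork P y = applyNetwork Q x from hy]
end

section
/- If G is a generalised sorting network with n channels and depth d, then there exists an (ordinary) sorting network C with n channels and depth d. Furthermore, if G = P ⨟ H where P is an ordinary comparator network (all comparators ⟨i,j⟩ of P satisfy i < j), then C can be chosen of the form C = P ⨟ I for some ordinary comparator network I with depth(I) = depth(H). -/
/-- A valid generalised layer: every comparator `⟨i,j⟩` satisfies `i ≠ j`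
and every channel occurs at most once in the layer. -/
def IsGenLayer {n : ℕ} (L : Layer n) : Prop :=
  (∀ c ∈ L, c.1 ≠ c.2) ∧ L.Pairwise ChDisjoint

/-- A valid generalised comparator network. -/
def IsGenNetwork {n : ℕ} (C : Network n) : Prop := ∀ L ∈ C, IsGenLayer L

/-- A generalised sorting network: a valid generalised comparator network `C`
for which there is a permutation `π_C` of the channels such that for every
Boolean input `x`, the sequence `i ↦ C(x)_{π_C(i)}` is sorted. -/
def IsGenSortingNetwork {n : ℕ} (C : Network n) : Prop :=
  IsGenNetwork C ∧ ∃ πC : Equiv.Perm (Fin n),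
    ∀ x : Fin n → Bool, Monotone (fun i => applyNetwork C x (πC i))

/-- A comparator acting after a relabelling `σ` of the channels can be replaced by an ordinary
comparator, at the price of changing `σ` to a relabelling `τ` on the affected channels. -/
lemma exists_ordinary_comparator {n : ℕ} (c : Comparator n) (hc : c.1 ≠ c.2)
    (σ : Equiv.Perm (Fin n)) :
    ∃ (c' : Comparator n) (τ : Equiv.Perm (Fin n)), c'.1 < c'.2 ∧ Prod.map τ τ c' = c ∧
      (∀ k, σ k ≠ c.1 → σ k ≠ c.2 → τ k = σ k) ∧
      ∀ v : Fin n → Bool, applyComparator c' (v ∘ σ) = applyComparator c v ∘ τ := by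
  obtain ⟨i, j⟩ := c
  obtain ⟨a, rfl⟩ := σ.surjective i
  obtain ⟨b, rfl⟩ := σ.surjective j
  have hab : a ≠ b := fun h => hc (congrArg σ h)
  rcases lt_or_gt_of_ne hab with h | h
  · refine ⟨(a, b), σ, h, rfl, fun _ _ _ => rfl, fun v => ?_⟩
    ext k
    simp [applyComparator]
  · refine ⟨(b, a), (Equiv.swap a b).trans σ, h, by simp, fun k hka hkb => ?_, fun v => ?_⟩
    · have hka' : k ≠ a := fun h => hka (congrArg σ h)
      have hkb' : k ≠ b := fun h => hkb (congrArg σ h)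
      simp [Equiv.swap_apply_of_ne_of_ne hka' hkb']
    · funext k
      by_cases hka : k = a
      · subst hka
        simp [applyComparator, hab, hab.symm, max_comm]
      · by_cases hkb : k = b
        · subst hkb
          simp [applyComparator, min_comm]
        · simp [applyComparator, hka, hkb, Equiv.swap_apply_of_ne_of_ne hka hkb]

lemma exists_ordinary_layer {n : ℕ} (L : Layer n) (hL : IsGenLayer L)
    (σ : Equiv.Perm (Fin n)) :
    ∃ (L' : Layer n) (τ : Equiv.Perm (Fin n)), (∀ c ∈ L', c.1 < c.2) ∧
      L'.map (Prod.map τ τ) = L ∧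
      (∀ k, (∀ c ∈ L, σ k ≠ c.1 ∧ σ k ≠ c.2) → τ k = σ k) ∧
      ∀ v : Fin n → Bool, applyLayer L' (v ∘ σ) = applyLayer L v ∘ τ := by
  induction L generalizing σ with
  | nil => exact ⟨[], σ, by simp, rfl, fun _ _ => rfl, fun _ => rfl⟩
  | cons c L ih =>
    obtain ⟨hne, hdisj⟩ := hL
    rw [List.pairwise_cons] at hdisj
    obtain ⟨c', τ, hlt, hmap, hfix, happ⟩ :=
      exists_ordinary_comparator c (hne c List.mem_cons_self) σ
    obtain ⟨L', ρ, hlt', hmap', hfix', happ'⟩ :=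
      ih ⟨fun d hd => hne d (List.mem_cons_of_mem _ hd), hdisj.2⟩ τ
    have h1 : τ c'.1 = c.1 := congrArg Prod.fst hmap
    have h2 : τ c'.2 = c.2 := congrArg Prod.snd hmap
    have h1' : ρ c'.1 = c.1 := by
      rw [hfix' _ fun d hd => ?_, h1]
      rw [h1]
      exact ⟨(hdisj.1 d hd).1, (hdisj.1 d hd).2.1⟩
    have h2' : ρ c'.2 = c.2 := by
      rw [hfix' _ fun d hd => ?_, h2]
      rw [h2]
      exact (hdisj.1 d hd).2.2
    refine ⟨c' :: L', ρ, ?_, ?_, fun k hk => ?_, fun v => ?_⟩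
    · simpa only [List.forall_mem_cons] using ⟨hlt, hlt'⟩
    · rw [List.map_cons, hmap']
      exact congrArg (· :: L) (Prod.ext h1' h2')
    · rw [List.forall_mem_cons] at hk
      have hτ := hfix k hk.1.1 hk.1.2
      rw [hfix' k (hτ ▸ hk.2), hτ]
    · change applyLayer L' (applyComparator c' (v ∘ σ)) = applyLayer L (applyComparator c v) ∘ ρ
      rw [happ, happ']

lemma exists_ordinary_network {n : ℕ} (H : Network n) (hH : IsGenNetwork H)
    (σ : Equiv.Perm (Fin n)) :
    ∃ (I : Network n) (τ : Equiv.Perm (Fin n)), IsNetwork I ∧ I.length = H.length ∧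
      ∀ v : Fin n → Bool, applyNetwork I (v ∘ σ) = applyNetwork H v ∘ τ := by
  induction H generalizing σ with
  | nil => exact ⟨[], σ, by simp [IsNetwork], rfl, fun _ => rfl⟩
  | cons L H ih =>
    obtain ⟨hL, hH⟩ := List.forall_mem_cons.1 hH
    obtain ⟨L', τ, hlt, hmap, -, happ⟩ := exists_ordinary_layer L hL σ
    obtain ⟨I, ρ, hI, hlen, happ'⟩ := ih hH τ
    have hL' : IsLayer L' := by
      refine ⟨hlt, ?_⟩
      have hdisj := hL.2
      rw [← hmap, List.pairwise_map] at hdisj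
      exact hdisj.imp fun h => by simpa [ChDisjoint] using h
    refine ⟨L' :: I, ρ, List.forall_mem_cons.2 ⟨hL', hI⟩, by simp [hlen], fun v => ?_⟩
    change applyNetwork I (applyLayer L' (v ∘ σ)) = applyNetwork H (applyLayer L v) ∘ ρ
    rw [happ, happ']

lemma applyComparator_eq_self {n : ℕ} {α : Type*} [LinearOrder α] {c : Comparator n}
    (hc : c.1 < c.2) {v : Fin n → α} (hv : Monotone v) : applyComparator c v = v := by
  funext k
  have := hv hc.le
  unfold applyComparator
  split_ifs with h1 h2
  · rw [h1, min_eq_left this]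
  · rw [h2, max_eq_right this]
  · rfl

lemma applyLayer_eq_self {n : ℕ} {α : Type*} [LinearOrder α] {L : Layer n}
    (hL : IsLayer L) {v : Fin n → α} (hv : Monotone v) : applyLayer L v = v :=
  List.foldlRecOn (motive := (· = v)) L _ rfl fun _ hw c hc => by
    rw [hw, applyComparator_eq_self (hL.1 c hc) hv]

lemma applyNetwork_eq_self {n : ℕ} {α : Type*} [LinearOrder α] {C : Network n}
    (hC : IsNetwork C) {v : Fin n → α} (hv : Monotone v) : applyNetwork C v = v :=
  List.foldlRecOn (motive := (· = v)) C _ rfl fun _ hw L hL => by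
    rw [hw, applyLayer_eq_self (hC L hL) hv]

/-- An ordinary network whose outputs are sorted by a fixed permutation of the channels
sorts by itself, since it leaves sorted inputs unchanged. -/
lemma IsNetwork.sorts_of_monotone_comp {n : ℕ} {C : Network n} (hC : IsNetwork C)
    (ρ : Equiv.Perm (Fin n)) (hρ : ∀ x : Fin n → Bool, Monotone (applyNetwork C x ∘ ρ)) :
    Sorts C := by
  have hid : ρ = 1 := by
    have key (x : Fin n → Bool) (hx : Monotone x) : x ∘ ρ = x := by
      have h := hρ x
      rw [applyNetwork_eq_self hC hx] at h
      exact Tuple.unique_monotone (σ := ρ) (τ := 1) h hx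
    ext1 i
    have hiff (k : Fin n) : k ≤ ρ i ↔ k ≤ i := by
      have hmono : Monotone fun m : Fin n => decide (k ≤ m) := fun a b hab hka =>
        decide_eq_true ((of_decide_eq_true hka).trans hab)
      simpa using congrFun (key _ hmono) i
    exact le_antisymm ((hiff _).1 le_rfl) ((hiff _).2 le_rfl)
  intro x
  simpa [hid] using hρ x

lemma IsGenSortingNetwork.exists_untangled_suffix {n : ℕ} {P H : Network n}
    (hG : IsGenSortingNetwork (P ++ H)) (hP : IsNetwork P) :
    ∃ I : Network n, IsNetwork I ∧ IsSortingNetwork (P ++ I) ∧ I.length = H.length := by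
  obtain ⟨hgen, π, hπ⟩ := hG
  obtain ⟨I, τ, hI, hlen, happ⟩ :=
    exists_ordinary_network H (fun L hL => hgen L (List.mem_append_right _ hL)) 1
  have hPI : IsNetwork (P ++ I) := List.forall_mem_append.2 ⟨hP, hI⟩
  refine ⟨I, hI, ⟨hPI, hPI.sorts_of_monotone_comp (τ⁻¹ * π) fun x => ?_⟩, hlen⟩
  have hout : applyNetwork (P ++ I) x = applyNetwork (P ++ H) x ∘ τ := by
    simpa [applyNetwork] using happ (applyNetwork P x)
  rw [hout]
  simpa [Function.comp_def] using hπ x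

/-- untangling: if `G` is a generalised sorting network with `n`
channels and depth `d`, then there is an ordinary sorting network with `n` channels
and depth `d`; furthermore if `G = P ⨟ H` with `P` ordinary, then it can be chosen
of the form `P ⨟ I` with `I` ordinary and `depth(I) = depth(H)`. -/
theorem statement_5 {n : ℕ} (G : Network n) (hG : IsGenSortingNetwork G) :
    (∃ C : Network n, IsSortingNetwork C ∧ C.length = G.length) ∧
    (∀ P H : Network n, G = P ++ H → IsNetwork P →
      ∃ I : Network n, IsNetwork I ∧ IsSortingNetwork (P ++ I) ∧
        I.length = H.length) := by
  refine ⟨?_, fun P H h hP => (h ▸ hG).exists_untangled_suffix hP⟩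
  obtain ⟨I, -, hI, hlen⟩ :=
    IsGenSortingNetwork.exists_untangled_suffix (P := []) (H := G) hG (by simp [IsNetwork])
  exact ⟨I, hI, hlen⟩
end
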